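/- (Theorem 1, no-go theorem for universal probabilistic purification via CPWP operations, upper bound) Let d ≥ 3 be an odd integer, δ ∈ [0,1], and p ∈ (0,1]. Let J be any positive semidefinite operator on (ℂ^d)^{⊗3} (interpreted as the Choi operator of a two-to-one purification protocol, with the first two factors as inputs and the third as output) satisfying: (i) the partial trace of J over the third factor is ≤ I_{d²} (trace non-increasing), (ii) Tr[((A^r ⊗ A^w)^T ⊗ A^v)·J] ≥ 0 for all r, w, v ∈ (ZMod d)² (complete positive-Wigner-preservation), and (iii) Tr[J · R^{T₁₂}] = p (success probability p). Then the normalized purification fidelity satisfies (1/p)·Tr[J · Q^{T₁₂}] ≤ 1 − (d−1)δ/d; that is, no CPWP two-to-one probabilistic protocol can increase the Haar-average fidelity of depolarized pure states beyond its unpurified value λ₀ = 1 − (d−1)δ/d. -/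

import Mathlib

open Matrix ComplexOrder

noncomputable section

/-- ω = exp(2πi/d). -/
def wUnit (d : ℕ) : ℂ := Complex.exp (2 * (Real.pi : ℂ) * Complex.I / d)

/-- τ = exp((d+1)πi/d). -/
def tUnit (d : ℕ) : ℂ := Complex.exp (((d : ℂ) + 1) * (Real.pi : ℂ) * Complex.I / d)

/-- The shift operator, X|k⟩ = |k+1⟩. -/
def shiftX (d : ℕ) : Matrix (ZMod d) (ZMod d) ℂ :=
  Matrix.of fun i j => if i = j + 1 then 1 else 0

/-- The clock operator, Z|k⟩ = ω^k |k⟩. -/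
def clockZ (d : ℕ) : Matrix (ZMod d) (ZMod d) ℂ :=
  Matrix.of fun i j => if i = j then wUnit d ^ j.val else 0

/-- The Heisenberg-Weyl operator T_u = τ^{-a₁a₂} Z^{a₁} X^{a₂}. -/
def HW (d : ℕ) [NeZero d] (u : ZMod d × ZMod d) : Matrix (ZMod d) (ZMod d) ℂ :=
  tUnit d ^ (-(u.1 * u.2)).val • (clockZ d ^ (u.1).val * shiftX d ^ (u.2).val)

/-- The phase space point operator at the origin, A^0 = (1/d) Σ_u T_u. -/
def A0 (d : ℕ) [NeZero d] : Matrix (ZMod d) (ZMod d) ℂ :=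
  (1 / (d : ℂ)) • ∑ u : ZMod d × ZMod d, HW d u

/-- The phase space point operator A^u = T_u A^0 (T_u)†. -/
def Apt (d : ℕ) [NeZero d] (u : ZMod d × ZMod d) : Matrix (ZMod d) (ZMod d) ℂ :=
  HW d u * A0 d * (HW d u)ᴴ

/-- Index type for (ℂ^d)^{⊗3} with factors indexed by ZMod d. -/
abbrev Idx (d : ℕ) := Fin 3 → ZMod d

/-- The operator on (ℂ^d)^{⊗3} permuting the tensor factors according to c ∈ S₃. -/
def Perm3 (d : ℕ) (c : Equiv.Perm (Fin 3)) : Matrix (Idx d) (Idx d) ℂ :=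
  Matrix.of fun i j => if ∀ k, i k = j (c⁻¹ k) then 1 else 0

/-- The tensor product A ⊗ B ⊗ C as an operator on (ℂ^d)^{⊗3}. -/
def kron3 (d : ℕ) (A B C : Matrix (ZMod d) (ZMod d) ℂ) : Matrix (Idx d) (Idx d) ℂ :=
  Matrix.of fun i j => A (i 0) (j 0) * B (i 1) (j 1) * C (i 2) (j 2)

/-- The projector onto the symmetric subspace of (ℂ^d)^{⊗3}. -/
def projSym3 (d : ℕ) [NeZero d] : Matrix (Idx d) (Idx d) ℂ :=
  ((6 : ℂ))⁻¹ • ∑ c : Equiv.Perm (Fin 3), Perm3 d c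

/-- The depolarizing map 𝒟_δ applied to tensor factor s of an operator on (ℂ^d)^{⊗3}. -/
def depOn (d : ℕ) [NeZero d] (δ : ℝ) (s : Fin 3) (M : Matrix (Idx d) (Idx d) ℂ) :
    Matrix (Idx d) (Idx d) ℂ :=
  Matrix.of fun i j => (1 - (δ : ℂ)) * M i j +
    ((δ : ℂ) / d) *
      (if i s = j s then ∑ k : ZMod d, M (Function.update i s k) (Function.update j s k) else 0)

/-- D(n,d) = binom(n+d−1, n), the dimension of the symmetric subspace. -/
def Dnd (n d : ℕ) : ℕ := Nat.choose (n + d - 1) n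

/-- Q = (𝒟_δ⊗𝒟_δ⊗id)(Π₃)/D(3,d), the Haar average of 𝒟_δ(ψ)⊗𝒟_δ(ψ)⊗ψ. -/
def Qop (d : ℕ) [NeZero d] (δ : ℝ) : Matrix (Idx d) (Idx d) ℂ :=
  ((Dnd 3 d : ℂ))⁻¹ • depOn d δ 0 (depOn d δ 1 (projSym3 d))

/-- R = ((𝒟_δ⊗𝒟_δ)(Π₂)/D(2,d)) ⊗ I_d, the Haar average of 𝒟_δ(ψ)⊗𝒟_δ(ψ)⊗I,
using Π₂ ⊗ I = (I + P((12)))/2 on (ℂ^d)^{⊗3}. -/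
def Rop (d : ℕ) [NeZero d] (δ : ℝ) : Matrix (Idx d) (Idx d) ℂ :=
  ((Dnd 2 d : ℂ))⁻¹ •
    depOn d δ 0 (depOn d δ 1 (((2 : ℂ))⁻¹ • (1 + Perm3 d (Equiv.swap 0 1))))

/-- The partial transpose on the first two tensor factors:
(M^{T₁₂})_{(i₁i₂i₃),(j₁j₂j₃)} = M_{(j₁j₂i₃),(i₁i₂j₃)}. -/
def pt12 (d : ℕ) (M : Matrix (Idx d) (Idx d) ℂ) : Matrix (Idx d) (Idx d) ℂ :=
  Matrix.of fun i j => M ![j 0, j 1, i 2] ![i 0, i 1, j 2]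

/-- The partial trace over the third tensor factor. -/
def ptrace3 (d : ℕ) [NeZero d] (M : Matrix (Idx d) (Idx d) ℂ) :
    Matrix (ZMod d × ZMod d) (ZMod d × ZMod d) ℂ :=
  Matrix.of fun a b => ∑ k : ZMod d, M ![a.1, a.2, k] ![b.1, b.2, k]

lemma wUnit_pow (d : ℕ) [NeZero d] (n : ℕ) :
    wUnit d ^ n = ZMod.stdAddChar (n : ZMod d) := by
  have h := ZMod.stdAddChar_coe (N := d) (n : ℤ)
  rw [Int.cast_natCast] at h
  rw [h, wUnit, ← Complex.exp_nat_mul]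
  congr 1
  push_cast
  ring

lemma tUnit_pow (d : ℕ) [NeZero d] {m : ℕ} (hm : d + 1 = 2 * m) (n : ℕ) :
    tUnit d ^ n = ZMod.stdAddChar ((m : ZMod d) * (n : ZMod d)) := by
  have ht : tUnit d = wUnit d ^ m := by
    rw [tUnit, wUnit, ← Complex.exp_nat_mul]
    congr 1
    have : (d : ℂ) + 1 = 2 * m := by exact_mod_cast hm
    rw [this]
    ring
  rw [ht, ← pow_mul, wUnit_pow, Nat.cast_mul]

lemma clockZ_pow_apply (d : ℕ) [NeZero d] (n : ℕ) (i j : ZMod d) :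
    (clockZ d ^ n) i j = if i = j then ZMod.stdAddChar ((n : ZMod d) * i) else 0 := by
  have hZ : clockZ d = diagonal fun k : ZMod d => wUnit d ^ k.val := by
    ext i j
    by_cases h : i = j <;> simp [clockZ, h]
  rw [hZ, diagonal_pow, diagonal_apply]
  refine if_congr Iff.rfl ?_ rfl
  simp only [Pi.pow_apply]
  rw [← pow_mul, wUnit_pow, Nat.cast_mul, ZMod.natCast_zmod_val, mul_comm]

lemma shiftX_pow_apply (d : ℕ) [NeZero d] (n : ℕ) (i j : ZMod d) :
    (shiftX d ^ n) i j = if i = j + n then 1 else 0 := by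
  induction n generalizing i with
  | zero => simp [one_apply]
  | succ n ih =>
    rw [pow_succ', mul_apply]
    have hX : ∀ k : ZMod d, shiftX d i k = if k = i - 1 then 1 else 0 := fun k => by
      simp only [shiftX, of_apply, eq_sub_iff_add_eq, eq_comm]
    simp only [ih, hX, ite_mul, one_mul, zero_mul, Finset.sum_ite_eq', Finset.mem_univ, if_true]
    simp only [sub_eq_iff_eq_add, Nat.cast_succ, add_assoc]

lemma HW_apply (d : ℕ) [NeZero d] {m : ℕ} (hm : d + 1 = 2 * m) (u : ZMod d × ZMod d)
    (i j : ZMod d) :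
    HW d u i j =
      if i = j + u.2 then ZMod.stdAddChar (u.1 * i - (m : ZMod d) * (u.1 * u.2)) else 0 := by
  rw [HW, Matrix.smul_apply, mul_apply, tUnit_pow d hm]
  simp only [clockZ_pow_apply, shiftX_pow_apply, ZMod.natCast_zmod_val, ite_mul, zero_mul,
    Finset.sum_ite_eq, Finset.mem_univ, if_true]
  simp only [mul_ite, mul_one, mul_zero, smul_eq_mul, ← AddChar.map_add_eq_mul]
  refine if_congr Iff.rfl ?_ rfl
  congr 1
  ring

lemma two_mul_half {d m : ℕ} (hm : d + 1 = 2 * m) : (2 : ZMod d) * m = 1 := by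
  have := congrArg (Nat.cast : ℕ → ZMod d) hm
  push_cast at this
  simpa using this.symm

lemma sum_stdAddChar_mul (d : ℕ) [NeZero d] (b : ZMod d) :
    ∑ x : ZMod d, ZMod.stdAddChar (x * b) = if b = 0 then (d : ℂ) else 0 := by
  have := AddChar.sum_mulShift b (ZMod.isPrimitive_stdAddChar d)
  rw [this, ZMod.card]
  split_ifs <;> simp

lemma A0_apply (d : ℕ) [NeZero d] {m : ℕ} (hm : d + 1 = 2 * m) (i j : ZMod d) :
    A0 d i j = if i + j = 0 then 1 else 0 := by
  have h2 := two_mul_half hm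
  have hd : (d : ℂ) ≠ 0 := NeZero.ne _
  have hpin : ∀ b : ZMod d, (i = j + b) ↔ (b = i - j) := fun b => by
    rw [eq_sub_iff_add_eq, add_comm, eq_comm]
  rw [A0, Matrix.smul_apply, Matrix.sum_apply, Fintype.sum_prod_type]
  simp only [HW_apply d hm, hpin, Finset.sum_ite_eq', Finset.mem_univ, if_true]
  have : ∀ x : ZMod d, x * i - (m : ZMod d) * (x * (i - j)) = x * (m * (i + j)) := fun x => by
    linear_combination (-x * i) * h2
  simp only [this, sum_stdAddChar_mul]
  have hiff : (m : ZMod d) * (i + j) = 0 ↔ i + j = 0 :=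
    ⟨fun h => by linear_combination 2 * h - (i + j) * h2, fun h => by rw [h, mul_zero]⟩
  simp only [hiff]
  split_ifs <;> simp [hd]

lemma star_stdAddChar (d : ℕ) [NeZero d] (x : ZMod d) :
    star (ZMod.stdAddChar x) = ZMod.stdAddChar (-x) := by
  rw [AddChar.map_neg_eq_conj]
  rfl

lemma Apt_apply (d : ℕ) [NeZero d] {m : ℕ} (hm : d + 1 = 2 * m) (u : ZMod d × ZMod d)
    (i j : ZMod d) :
    Apt d u i j =
      if u.2 = (m : ZMod d) * (i + j) then ZMod.stdAddChar (u.1 * (i - j)) else 0 := by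
  have h2 := two_mul_half hm
  have hpin : ∀ a b : ZMod d, (a = b + u.2) ↔ (b = a - u.2) := fun a b => by
    rw [eq_sub_iff_add_eq, eq_comm]
  have hpin' : ∀ a b : ZMod d, (a + b = 0) ↔ (a = -b) := fun a b => add_eq_zero_iff_eq_neg
  rw [Apt, mul_apply]
  simp only [mul_apply, conjTranspose_apply, HW_apply d hm, A0_apply d hm, hpin, hpin', mul_ite,
    mul_one, mul_zero, Finset.sum_ite_eq', Finset.mem_univ, if_true, apply_ite star, star_zero,
    ite_mul, zero_mul, star_stdAddChar, ← AddChar.map_add_eq_mul]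
  have hiff : -(j - u.2) = i - u.2 ↔ u.2 = (m : ZMod d) * (i + j) :=
    ⟨fun h => by linear_combination (m : ZMod d) * h - u.2 * h2,
      fun h => by linear_combination 2 * h + (i + j) * h2⟩
  simp only [hiff]
  refine if_congr Iff.rfl ?_ rfl
  congr 1
  ring

lemma Perm3_one_apply (d : ℕ) (i j : Idx d) :
    Perm3 d 1 i j = if i 0 = j 0 ∧ i 1 = j 1 ∧ i 2 = j 2 then 1 else 0 := by
  simp [Perm3, Fin.forall_fin_succ]

lemma Perm3_swap01_apply (d : ℕ) (i j : Idx d) :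
    Perm3 d (Equiv.swap 0 1) i j = if i 0 = j 1 ∧ i 1 = j 0 ∧ i 2 = j 2 then 1 else 0 := by
  have h : (Equiv.swap (0 : Fin 3) 1) 2 = 2 := by decide
  simp [Perm3, Fin.forall_fin_succ, h]

lemma Perm3_swap02_apply (d : ℕ) (i j : Idx d) :
    Perm3 d (Equiv.swap 0 2) i j = if i 0 = j 2 ∧ i 1 = j 1 ∧ i 2 = j 0 then 1 else 0 := by
  have h : (Equiv.swap (0 : Fin 3) 2) 1 = 1 := by decide
  simp [Perm3, Fin.forall_fin_succ, h]

lemma Perm3_swap12_apply (d : ℕ) (i j : Idx d) :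
    Perm3 d (Equiv.swap 1 2) i j = if i 0 = j 0 ∧ i 1 = j 2 ∧ i 2 = j 1 then 1 else 0 := by
  have h : (Equiv.swap (1 : Fin 3) 2) 0 = 0 := by decide
  simp [Perm3, Fin.forall_fin_succ, h]

lemma Perm3_rotate_apply (d : ℕ) (i j : Idx d) :
    Perm3 d (finRotate 3) i j = if i 0 = j 2 ∧ i 1 = j 0 ∧ i 2 = j 1 then 1 else 0 := by
  have h : ∀ k, (finRotate 3)⁻¹ k = ![2, 0, 1] k := by decide
  simp [Perm3, Fin.forall_fin_succ, h]

lemma Perm3_rotate_inv_apply (d : ℕ) (i j : Idx d) :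
    Perm3 d (finRotate 3)⁻¹ i j = if i 0 = j 1 ∧ i 1 = j 2 ∧ i 2 = j 0 then 1 else 0 := by
  have h : ∀ k, (finRotate 3)⁻¹⁻¹ k = ![1, 2, 0] k := by decide
  simp only [Perm3, of_apply, h]
  simp [Fin.forall_fin_succ]

lemma Perm3_one (d : ℕ) : Perm3 d 1 = 1 := by
  ext i j
  rw [Perm3_one_apply, one_apply]
  refine if_congr ?_ rfl rfl
  simp [funext_iff, Fin.forall_fin_succ]

lemma sum_perm_fin_three {M : Type*} [AddCommMonoid M] (f : Equiv.Perm (Fin 3) → M) :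
    ∑ c, f c = f 1 + f (Equiv.swap 0 1) + f (Equiv.swap 0 2) + f (Equiv.swap 1 2) +
      f (finRotate 3) + f (finRotate 3)⁻¹ := by
  have h : (Finset.univ : Finset (Equiv.Perm (Fin 3))) =
      {1, Equiv.swap 0 1, Equiv.swap 0 2, Equiv.swap 1 2, finRotate 3, (finRotate 3)⁻¹} := by
    decide
  rw [h, Finset.sum_insert (by decide), Finset.sum_insert (by decide),
    Finset.sum_insert (by decide), Finset.sum_insert (by decide), Finset.sum_insert (by decide),
    Finset.sum_singleton]
  simp only [add_assoc]

lemma depOn_add (d : ℕ) [NeZero d] (δ : ℝ) (s : Fin 3) (M N : Matrix (Idx d) (Idx d) ℂ) :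
    depOn d δ s (M + N) = depOn d δ s M + depOn d δ s N := by
  ext i j
  simp only [depOn, of_apply, Matrix.add_apply, Finset.sum_add_distrib]
  split_ifs <;> ring

lemma depOn_smul (d : ℕ) [NeZero d] (δ : ℝ) (s : Fin 3) (c : ℂ) (M : Matrix (Idx d) (Idx d) ℂ) :
    depOn d δ s (c • M) = c • depOn d δ s M := by
  ext i j
  simp only [depOn, of_apply, Matrix.smul_apply, smul_eq_mul, ← Finset.mul_sum]
  split_ifs <;> ring

/-- If tracing out factor `s` of `M` leaves the operator `N` (tensored with the identity on
factor `s`), then the depolarizing map mixes `M` with `N`. -/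
lemma depOn_eq (d : ℕ) [NeZero d] (δ : ℝ) (s : Fin 3) (M N : Matrix (Idx d) (Idx d) ℂ)
    (h : ∀ i j, (if i s = j s then
      ∑ k : ZMod d, M (Function.update i s k) (Function.update j s k) else 0) = N i j) :
    depOn d δ s M = (1 - (δ : ℂ)) • M + ((δ : ℂ) / d) • N := by
  ext i j
  simp only [depOn, of_apply, h, Matrix.add_apply, Matrix.smul_apply, smul_eq_mul]

/-- The depolarizing map fixes an operator that is the identity on factor `s`. -/
lemma depOn_eq_self (d : ℕ) [NeZero d] (δ : ℝ) (s : Fin 3) (M : Matrix (Idx d) (Idx d) ℂ)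
    (h : ∀ i j, (if i s = j s then
      ∑ k : ZMod d, M (Function.update i s k) (Function.update j s k) else 0) = d * M i j) :
    depOn d δ s M = M := by
  have hd : (d : ℂ) ≠ 0 := NeZero.ne _
  rw [depOn_eq d δ s M ((d : ℂ) • M) h, smul_smul, ← add_smul, div_mul_cancel₀ _ hd,
    sub_add_cancel, one_smul]

section Depolarizing

variable (d : ℕ) [NeZero d] (δ : ℝ)

lemma depOn_0_one : depOn d δ 0 (Perm3 d 1) = Perm3 d 1 := by
  refine depOn_eq_self d δ 0 _ fun i j => ?_
  simp [Perm3_one_apply, Function.update]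
  split_ifs <;> simp_all

lemma depOn_0_swap01 : depOn d δ 0 (Perm3 d (Equiv.swap 0 1)) =
    (1 - (δ : ℂ)) • Perm3 d (Equiv.swap 0 1) + ((δ : ℂ) / d) • Perm3 d 1 := by
  refine depOn_eq d δ 0 _ _ fun i j => ?_
  simp only [Perm3_swap01_apply, Perm3_one_apply, Function.update]
  simp [ite_and]

lemma depOn_0_swap02 : depOn d δ 0 (Perm3 d (Equiv.swap 0 2)) =
    (1 - (δ : ℂ)) • Perm3 d (Equiv.swap 0 2) + ((δ : ℂ) / d) • Perm3 d 1 := by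
  refine depOn_eq d δ 0 _ _ fun i j => ?_
  simp only [Perm3_swap02_apply, Perm3_one_apply, Function.update]
  simp [ite_and]

lemma depOn_0_swap12 : depOn d δ 0 (Perm3 d (Equiv.swap 1 2)) = Perm3 d (Equiv.swap 1 2) := by
  refine depOn_eq_self d δ 0 _ fun i j => ?_
  simp [Perm3_swap12_apply, Function.update]
  split_ifs <;> simp_all

lemma depOn_0_rotate : depOn d δ 0 (Perm3 d (finRotate 3)) =
    (1 - (δ : ℂ)) • Perm3 d (finRotate 3) + ((δ : ℂ) / d) • Perm3 d (Equiv.swap 1 2) := by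
  refine depOn_eq d δ 0 _ _ fun i j => ?_
  simp only [Perm3_rotate_apply, Perm3_swap12_apply, Function.update]
  simp [ite_and]

lemma depOn_0_rotate_inv : depOn d δ 0 (Perm3 d (finRotate 3)⁻¹) =
    (1 - (δ : ℂ)) • Perm3 d (finRotate 3)⁻¹ + ((δ : ℂ) / d) • Perm3 d (Equiv.swap 1 2) := by
  refine depOn_eq d δ 0 _ _ fun i j => ?_
  simp only [Perm3_rotate_inv_apply, Perm3_swap12_apply, Function.update]
  simp [ite_and]

lemma depOn_1_one : depOn d δ 1 (Perm3 d 1) = Perm3 d 1 := by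
  refine depOn_eq_self d δ 1 _ fun i j => ?_
  simp [Perm3_one_apply, Function.update]
  split_ifs <;> simp_all

lemma depOn_1_swap01 : depOn d δ 1 (Perm3 d (Equiv.swap 0 1)) =
    (1 - (δ : ℂ)) • Perm3 d (Equiv.swap 0 1) + ((δ : ℂ) / d) • Perm3 d 1 := by
  refine depOn_eq d δ 1 _ _ fun i j => ?_
  simp only [Perm3_swap01_apply, Perm3_one_apply, Function.update]
  simp [ite_and]
  split_ifs <;> rfl

lemma depOn_1_swap02 : depOn d δ 1 (Perm3 d (Equiv.swap 0 2)) = Perm3 d (Equiv.swap 0 2) := by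
  refine depOn_eq_self d δ 1 _ fun i j => ?_
  simp [Perm3_swap02_apply, Function.update]
  split_ifs <;> simp_all

lemma depOn_1_swap12 : depOn d δ 1 (Perm3 d (Equiv.swap 1 2)) =
    (1 - (δ : ℂ)) • Perm3 d (Equiv.swap 1 2) + ((δ : ℂ) / d) • Perm3 d 1 := by
  refine depOn_eq d δ 1 _ _ fun i j => ?_
  simp only [Perm3_swap12_apply, Perm3_one_apply, Function.update]
  simp [ite_and]
  split_ifs <;> rfl

lemma depOn_1_rotate : depOn d δ 1 (Perm3 d (finRotate 3)) =
    (1 - (δ : ℂ)) • Perm3 d (finRotate 3) + ((δ : ℂ) / d) • Perm3 d (Equiv.swap 0 2) := by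
  refine depOn_eq d δ 1 _ _ fun i j => ?_
  simp only [Perm3_rotate_apply, Perm3_swap02_apply, Function.update]
  simp [ite_and]
  split_ifs <;> rfl

lemma depOn_1_rotate_inv : depOn d δ 1 (Perm3 d (finRotate 3)⁻¹) =
    (1 - (δ : ℂ)) • Perm3 d (finRotate 3)⁻¹ + ((δ : ℂ) / d) • Perm3 d (Equiv.swap 0 2) := by
  refine depOn_eq d δ 1 _ _ fun i j => ?_
  simp only [Perm3_rotate_inv_apply, Perm3_swap02_apply, Function.update]
  simp [ite_and]
  split_ifs <;> rfl

end Depolarizing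

/-- The unnormalized maximally entangled projector on factors 1 and 3. -/
def bell13 (d : ℕ) : Matrix (Idx d) (Idx d) ℂ :=
  Matrix.of fun i j => if i 0 = i 2 ∧ j 0 = j 2 ∧ i 1 = j 1 then 1 else 0

/-- The operator exchanging factors 1 and 2. -/
def flip12 (d : ℕ) : Matrix (Idx d) (Idx d) ℂ := Perm3 d (Equiv.swap 0 1)

lemma flip12_apply (d : ℕ) (i j : Idx d) :
    flip12 d i j = if j = ![i 1, i 0, i 2] then 1 else 0 := by
  rw [flip12, Perm3_swap01_apply]
  refine if_congr ?_ rfl rfl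
  simp only [funext_iff, Fin.forall_fin_succ]
  simp
  grind

lemma flip12_apply' (d : ℕ) (i j : Idx d) :
    flip12 d i j = if i = ![j 1, j 0, j 2] then 1 else 0 := by
  rw [flip12, Perm3_swap01_apply]
  refine if_congr ?_ rfl rfl
  simp [funext_iff, Fin.forall_fin_succ]

lemma flip12_mul_apply (d : ℕ) [NeZero d] (M : Matrix (Idx d) (Idx d) ℂ) (i j : Idx d) :
    (flip12 d * M) i j = M ![i 1, i 0, i 2] j := by
  simp [mul_apply, flip12_apply]

lemma mul_flip12_apply (d : ℕ) [NeZero d] (M : Matrix (Idx d) (Idx d) ℂ) (i j : Idx d) :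
    (M * flip12 d) i j = M i ![j 1, j 0, j 2] := by
  simp [mul_apply, flip12_apply']

lemma flip12_mul_self (d : ℕ) [NeZero d] : flip12 d * flip12 d = 1 := by
  ext i j
  rw [flip12_mul_apply, flip12, Perm3_swap01_apply, ← Perm3_one, Perm3_one_apply]
  refine if_congr ?_ rfl rfl
  simp
  tauto

lemma sum_idx (d : ℕ) [NeZero d] (f : Idx d → ℂ) :
    ∑ k, f k = ∑ a, ∑ b, ∑ c, f ![a, b, c] := by
  rw [← (Fin.consEquiv fun _ : Fin 3 => ZMod d).sum_comp, Fintype.sum_prod_type]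
  refine Finset.sum_congr rfl fun a _ => ?_
  rw [← (Fin.consEquiv fun _ : Fin 2 => ZMod d).sum_comp, Fintype.sum_prod_type]
  refine Finset.sum_congr rfl fun b _ => ?_
  rw [← (Fin.consEquiv fun _ : Fin 1 => ZMod d).sum_comp, Fintype.sum_prod_type]
  refine Finset.sum_congr rfl fun c _ => ?_
  simp
  rfl

lemma bell13_mul_self (d : ℕ) [NeZero d] : bell13 d * bell13 d = (d : ℂ) • bell13 d := by
  ext i j
  rw [mul_apply, sum_idx]
  simp only [bell13, of_apply, Matrix.smul_apply]
  simp [ite_and]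
  split_ifs <;> simp_all [ite_and, -Finset.sum_boole]

lemma bell13_mul_flip12_mul_bell13 (d : ℕ) [NeZero d] :
    bell13 d * flip12 d * bell13 d = bell13 d := by
  ext i j
  rw [mul_apply, sum_idx]
  simp only [mul_flip12_apply]
  simp only [bell13, of_apply]
  simp [ite_and]
  split_ifs <;> simp_all [ite_and, -Finset.sum_boole]

lemma bell13_conjTranspose (d : ℕ) : (bell13 d)ᴴ = bell13 d := by
  ext i j
  simp only [bell13, conjTranspose_apply, of_apply, apply_ite star, star_one, star_zero]
  refine if_congr ?_ rfl rfl
  tauto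

lemma flip12_conjTranspose (d : ℕ) : (flip12 d)ᴴ = flip12 d := by
  ext i j
  simp only [flip12, conjTranspose_apply, Perm3_swap01_apply, apply_ite star, star_one, star_zero]
  refine if_congr ?_ rfl rfl
  tauto

lemma pt12_one (d : ℕ) : pt12 d (Perm3 d 1) = 1 := by
  rw [← Perm3_one]
  ext i j
  simp only [pt12, of_apply, Perm3_one_apply]
  refine if_congr ?_ rfl rfl
  simp
  tauto

lemma pt12_swap01 (d : ℕ) : pt12 d (Perm3 d (Equiv.swap 0 1)) = flip12 d := by
  ext i j
  simp only [pt12, of_apply, flip12, Perm3_swap01_apply]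
  refine if_congr ?_ rfl rfl
  simp
  tauto

lemma pt12_swap02 (d : ℕ) : pt12 d (Perm3 d (Equiv.swap 0 2)) = bell13 d := by
  ext i j
  simp only [pt12, of_apply, bell13, Perm3_swap02_apply]
  refine if_congr ?_ rfl rfl
  simp
  tauto

lemma pt12_swap12 (d : ℕ) [NeZero d] :
    pt12 d (Perm3 d (Equiv.swap 1 2)) = flip12 d * bell13 d * flip12 d := by
  ext i j
  simp only [pt12, of_apply, mul_flip12_apply, flip12_mul_apply, bell13, Perm3_swap12_apply]
  refine if_congr ?_ rfl rfl
  simp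
  tauto

lemma pt12_rotate (d : ℕ) [NeZero d] :
    pt12 d (Perm3 d (finRotate 3)) = flip12 d * bell13 d := by
  ext i j
  simp only [pt12, of_apply, flip12_mul_apply, bell13, Perm3_rotate_apply]
  refine if_congr ?_ rfl rfl
  simp
  tauto

lemma pt12_rotate_inv (d : ℕ) [NeZero d] :
    pt12 d (Perm3 d (finRotate 3)⁻¹) = bell13 d * flip12 d := by
  ext i j
  simp only [pt12, of_apply, mul_flip12_apply, bell13, Perm3_rotate_inv_apply]
  refine if_congr ?_ rfl rfl
  simp
  tauto

lemma pt12_add (d : ℕ) (M N : Matrix (Idx d) (Idx d) ℂ) :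
    pt12 d (M + N) = pt12 d M + pt12 d N := rfl

lemma pt12_smul (d : ℕ) (c : ℂ) (M : Matrix (Idx d) (Idx d) ℂ) :
    pt12 d (c • M) = c • pt12 d M := rfl

lemma pt12_kron3 (d : ℕ) (A B C : Matrix (ZMod d) (ZMod d) ℂ) :
    pt12 d (kron3 d A B C) = kron3 d Aᵀ Bᵀ C := rfl

/-- Twice the symplectic area spanned by three phase space points. -/
def sympArea (d : ℕ) (r w v : ZMod d × ZMod d) : ZMod d :=
  2 * (r.1 * (w.2 - v.2) + w.1 * (v.2 - r.2) + v.1 * (r.2 - w.2))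

lemma sum_mul_Apt_apply (d : ℕ) [NeZero d] {m : ℕ} (hm : d + 1 = 2 * m)
    (f : ZMod d × ZMod d → ℂ) (i j : ZMod d) :
    ∑ u, f u * Apt d u i j =
      ∑ a : ZMod d, f (a, (m : ZMod d) * (i + j)) * ZMod.stdAddChar (a * (i - j)) := by
  simp only [Apt_apply d hm, Fintype.sum_prod_type, mul_ite, mul_zero, Finset.sum_ite_eq',
    Finset.mem_univ, if_true]

lemma sum_sympArea_smul_kron3_apply (d : ℕ) [NeZero d] (hodd : Odd d) (c : ZMod d)
    (i j : Idx d) :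
    (∑ r, ∑ w, ∑ v, ZMod.stdAddChar (c * sympArea d r w v) •
      kron3 d (Apt d r) (Apt d w) (Apt d v)) i j =
      if i 0 - j 0 + c * (i 1 + j 1 - (i 2 + j 2)) = 0 ∧
        i 1 - j 1 + c * (i 2 + j 2 - (i 0 + j 0)) = 0 ∧
        i 2 - j 2 + c * (i 0 + j 0 - (i 1 + j 1)) = 0 then (d : ℂ) ^ 3 else 0 := by
  obtain ⟨k, hk⟩ := hodd
  have hm : d + 1 = 2 * (k + 1) := by omega
  have h2 := two_mul_half hm
  simp only [Matrix.sum_apply, Matrix.smul_apply, kron3, of_apply, smul_eq_mul]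
  simp only [← mul_assoc, sum_mul_Apt_apply d hm]
  have hw : ∀ r w : ZMod d × ZMod d, ∀ g : ZMod d → ℂ,
      ∑ a, ZMod.stdAddChar (c * sympArea d r w (a, ((k + 1 : ℕ) : ZMod d) * (i 2 + j 2))) *
        Apt d r (i 0) (j 0) * Apt d w (i 1) (j 1) * g a =
      (∑ a, ZMod.stdAddChar (c * sympArea d r w (a, ((k + 1 : ℕ) : ZMod d) * (i 2 + j 2))) *
        g a) * Apt d r (i 0) (j 0) * Apt d w (i 1) (j 1) := fun r w g => by
    simp only [Finset.sum_mul]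
    exact Finset.sum_congr rfl fun _ _ => by ring
  simp only [hw, sum_mul_Apt_apply d hm]
  have hr : ∀ r : ZMod d × ZMod d, ∀ g : ZMod d → ℂ, ∀ f : ZMod d → ℂ,
      ∑ a, f a * Apt d r (i 0) (j 0) * g a = (∑ a, f a * g a) * Apt d r (i 0) (j 0) :=
    fun r g f => by
      simp only [Finset.sum_mul]
      exact Finset.sum_congr rfl fun _ _ => by ring
  simp only [hr, sum_mul_Apt_apply d hm]
  have hfac : ∀ a b e : ZMod d,
      ZMod.stdAddChar (c * sympArea d (a, ((k + 1 : ℕ) : ZMod d) * (i 0 + j 0))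
        (b, ((k + 1 : ℕ) : ZMod d) * (i 1 + j 1)) (e, ((k + 1 : ℕ) : ZMod d) * (i 2 + j 2))) *
        ZMod.stdAddChar (e * (i 2 - j 2)) * ZMod.stdAddChar (b * (i 1 - j 1)) *
        ZMod.stdAddChar (a * (i 0 - j 0)) =
      ZMod.stdAddChar (a * (i 0 - j 0 + c * (i 1 + j 1 - (i 2 + j 2)))) *
      (ZMod.stdAddChar (b * (i 1 - j 1 + c * (i 2 + j 2 - (i 0 + j 0)))) *
      ZMod.stdAddChar (e * (i 2 - j 2 + c * (i 0 + j 0 - (i 1 + j 1))))) := fun a b e => by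
    simp only [← AddChar.map_add_eq_mul, sympArea]
    congr 1
    linear_combination (c * (a * ((i 1 + j 1) - (i 2 + j 2)) + b * ((i 2 + j 2) - (i 0 + j 0))
      + e * ((i 0 + j 0) - (i 1 + j 1)))) * h2
  simp only [Finset.sum_mul, hfac, ← Finset.mul_sum, sum_stdAddChar_mul]
  simp only [← Finset.sum_mul, sum_stdAddChar_mul]
  simp only [ite_and]
  split_ifs <;> ring

lemma two_cancel {d : ℕ} (hodd : Odd d) {x y : ZMod d} (h : 2 * x = 2 * y) : x = y := by
  obtain ⟨k, hk⟩ := hodd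
  have h2 := two_mul_half (show d + 1 = 2 * (k + 1) by omega)
  linear_combination ((k + 1 : ℕ) : ZMod d) * h - (x - y) * h2

lemma sum_kron3_Apt (d : ℕ) [NeZero d] (hodd : Odd d) :
    ∑ r, ∑ w, ∑ v, kron3 d (Apt d r) (Apt d w) (Apt d v) = (d : ℂ) ^ 3 • Perm3 d 1 := by
  ext i j
  have h := sum_sympArea_smul_kron3_apply d hodd 0 i j
  simp only [zero_mul, AddChar.map_zero_eq_one, one_smul, add_zero, sub_eq_zero] at h
  rw [h, Matrix.smul_apply, Perm3_one_apply]
  simp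

lemma sum_sympArea_smul_kron3 (d : ℕ) [NeZero d] (hodd : Odd d) :
    ∑ r, ∑ w, ∑ v, ZMod.stdAddChar (sympArea d r w v) •
      kron3 d (Apt d r) (Apt d w) (Apt d v) = (d : ℂ) ^ 3 • Perm3 d (finRotate 3) := by
  ext i j
  have h := sum_sympArea_smul_kron3_apply d hodd 1 i j
  simp only [one_mul] at h
  rw [h, Matrix.smul_apply, Perm3_rotate_apply, smul_eq_mul, mul_ite, mul_one, mul_zero]
  refine if_congr ⟨fun ⟨h₀, h₁, h₂⟩ => ⟨?_, ?_, ?_⟩, fun ⟨h₀, h₁, h₂⟩ => ?_⟩ rfl rfl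
  · exact two_cancel hodd (by linear_combination h₀ + h₂)
  · exact two_cancel hodd (by linear_combination h₀ + h₁)
  · exact two_cancel hodd (by linear_combination h₁ + h₂)
  · rw [h₀, h₁, h₂]
    exact ⟨by ring, by ring, by ring⟩

lemma sum_neg_sympArea_smul_kron3 (d : ℕ) [NeZero d] (hodd : Odd d) :
    ∑ r, ∑ w, ∑ v, ZMod.stdAddChar (-sympArea d r w v) •
      kron3 d (Apt d r) (Apt d w) (Apt d v) = (d : ℂ) ^ 3 • Perm3 d (finRotate 3)⁻¹ := by
  ext i j
  have h := sum_sympArea_smul_kron3_apply d hodd (-1) i j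
  simp only [neg_one_mul] at h
  rw [h, Matrix.smul_apply, Perm3_rotate_inv_apply, smul_eq_mul, mul_ite, mul_one, mul_zero]
  refine if_congr ⟨fun ⟨h₀, h₁, h₂⟩ => ⟨?_, ?_, ?_⟩, fun ⟨h₀, h₁, h₂⟩ => ?_⟩ rfl rfl
  · exact two_cancel hodd (by linear_combination h₀ + h₁)
  · exact two_cancel hodd (by linear_combination h₁ + h₂)
  · exact two_cancel hodd (by linear_combination h₀ + h₂)
  · rw [h₀, h₁, h₂]
    exact ⟨by ring, by ring, by ring⟩

/-- The Wigner function of `2 - P(c) - P(c⁻¹)`, for a three-cycle `c`, is nonnegative. -/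
lemma sum_weight_smul_kron3 (d : ℕ) [NeZero d] (hodd : Odd d) :
    ∑ r, ∑ w, ∑ v, ((2 - 2 * (ZMod.stdAddChar (sympArea d r w v)).re : ℝ) : ℂ) •
      kron3 d (Apt d r) (Apt d w) (Apt d v) =
      (d : ℂ) ^ 3 • ((2 : ℂ) • Perm3 d 1 + (-1 : ℂ) • Perm3 d (finRotate 3) +
        (-1 : ℂ) • Perm3 d (finRotate 3)⁻¹) := by
  have hwt : ∀ x : ZMod d, ((2 - 2 * (ZMod.stdAddChar x).re : ℝ) : ℂ) =
      2 + (-1) * ZMod.stdAddChar x + (-1) * ZMod.stdAddChar (-x) := fun x => by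
    rw [AddChar.map_neg_eq_conj]
    have := Complex.add_conj (ZMod.stdAddChar x)
    push_cast at this ⊢
    linear_combination this
  simp only [hwt, add_smul, mul_smul, Finset.sum_add_distrib, ← Finset.smul_sum,
    sum_kron3_Apt d hodd, sum_sympArea_smul_kron3 d hodd, sum_neg_sympArea_smul_kron3 d hodd,
    smul_add, smul_comm ((d : ℂ) ^ 3)]

lemma trace_mul_pt12_cyclic_re_nonneg (d : ℕ) [NeZero d] (hodd : Odd d)
    (J : Matrix (Idx d) (Idx d) ℂ)
    (hJ : ∀ r w v : ZMod d × ZMod d,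
      0 ≤ ((kron3 d (Apt d r)ᵀ (Apt d w)ᵀ (Apt d v) * J).trace).re) :
    0 ≤ (J * ((2 : ℂ) • 1 + (-1 : ℂ) • (flip12 d * bell13 d) +
      (-1 : ℂ) • (bell13 d * flip12 d))).trace.re := by
  let L : Matrix (Idx d) (Idx d) ℂ →ₗ[ℂ] ℂ :=
    { toFun := fun M => (J * pt12 d M).trace
      map_add' := fun M N => by rw [pt12_add, mul_add, trace_add]
      map_smul' := fun c M => by
        rw [pt12_smul, Matrix.mul_smul, trace_smul, RingHom.id_apply] }
  have hL := congrArg (fun M => (L M).re) (sum_weight_smul_kron3 d hodd)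
  have hrhs : L ((2 : ℂ) • Perm3 d 1 + (-1 : ℂ) • Perm3 d (finRotate 3) +
        (-1 : ℂ) • Perm3 d (finRotate 3)⁻¹) =
      (J * ((2 : ℂ) • 1 + (-1 : ℂ) • (flip12 d * bell13 d) +
      (-1 : ℂ) • (bell13 d * flip12 d))).trace := by
    rw [← pt12_one, ← pt12_rotate, ← pt12_rotate_inv]
    rfl
  simp only [map_sum, map_smul, hrhs, smul_eq_mul] at hL
  have hcast : (d : ℂ) ^ 3 = (((d : ℝ) ^ 3 : ℝ) : ℂ) := by push_cast; rfl
  rw [hcast, Complex.re_ofReal_mul] at hL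
  have hpos : (0 : ℝ) < (d : ℝ) ^ 3 := by
    have : 0 < d := NeZero.pos d
    positivity
  refine nonneg_of_mul_nonneg_right (a := (d : ℝ) ^ 3) ?_ hpos
  rw [← hL]
  simp only [Complex.re_sum]
  refine Finset.sum_nonneg fun r _ => Finset.sum_nonneg fun w _ => Finset.sum_nonneg fun v _ => ?_
  rw [Complex.re_ofReal_mul]
  refine mul_nonneg ?_ ?_
  · have h1 : ‖ZMod.stdAddChar (sympArea d r w v)‖ = 1 := AddChar.norm_apply _ _
    have := Complex.re_le_norm (ZMod.stdAddChar (sympArea d r w v))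
    linarith
  · have := hJ r w v
    rwa [trace_mul_comm, ← pt12_kron3] at this

lemma trace_mul_re_nonneg_of_idempotent {n : Type*} [Fintype n] [DecidableEq n]
    {J P : Matrix n n ℂ} (hJ : J.PosSemidef) (hP : Pᴴ = P) (hPP : P * P = P) :
    0 ≤ (J * P).trace.re := by
  have h : (J * P).trace = (Pᴴ * J * P).trace := by
    rw [hP, trace_mul_comm (P * J) P, ← mul_assoc, hPP, trace_mul_comm]
  rw [h]
  exact (Complex.le_def.mp (hJ.conjTranspose_mul_mul_same P).trace_nonneg).1

/-- The projector onto the `ε`-eigenspace of the exchange of factors 1 and 2, restricted to the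
orthogonal complement of the maximally entangled vectors. -/
def complProj (d : ℕ) [NeZero d] (ε : ℂ) : Matrix (Idx d) (Idx d) ℂ :=
  (2 : ℂ)⁻¹ • (1 + ε • flip12 d) -
    (2 * (d + ε))⁻¹ • ((1 + ε • flip12 d) * bell13 d * (1 + ε • flip12 d))

lemma complProj_conjTranspose (d : ℕ) [NeZero d] {ε : ℂ} (hε : star ε = ε) :
    (complProj d ε)ᴴ = complProj d ε := by
  simp [complProj, flip12_conjTranspose, bell13_conjTranspose, hε, mul_assoc]

lemma complProj_mul_self (d : ℕ) [NeZero d] {ε : ℂ} (hε : ε * ε = 1) (hd : (d : ℂ) + ε ≠ 0) :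
    complProj d ε * complProj d ε = complProj d ε := by
  set S : Matrix (Idx d) (Idx d) ℂ := 1 + ε • flip12 d with hS
  have hSS : S * S = (2 : ℂ) • S := by
    simp only [hS, add_mul, mul_add, one_mul, mul_one, Matrix.smul_mul, Matrix.mul_smul,
      flip12_mul_self, smul_smul, hε]
    module
  have hB : bell13 d * S * bell13 d = (d + ε) • bell13 d := by
    simp only [hS, add_mul, mul_add, mul_one, Matrix.smul_mul, Matrix.mul_smul,
      bell13_mul_self, bell13_mul_flip12_mul_bell13, add_smul]
  set E := S * bell13 d * S with hE
  have hSE : S * E = (2 : ℂ) • E := by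
    rw [hE, ← mul_assoc, ← mul_assoc, hSS, Matrix.smul_mul, Matrix.smul_mul]
  have hES : E * S = (2 : ℂ) • E := by
    rw [hE, mul_assoc, hSS, Matrix.mul_smul]
  have hEE : E * E = (2 * (d + ε)) • E := by
    calc E * E = (E * S) * bell13 d * S := by rw [hE]; noncomm_ring
      _ = (2 : ℂ) • (S * (bell13 d * S * bell13 d) * S) := by
        rw [hES, hE, Matrix.smul_mul, Matrix.smul_mul]; noncomm_ring
      _ = (2 * (d + ε)) • E := by
        rw [hB, Matrix.mul_smul, Matrix.smul_mul, smul_smul]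
  have hP : complProj d ε = (2 : ℂ)⁻¹ • S - (2 * (d + ε))⁻¹ • E := rfl
  rw [hP]
  simp only [sub_mul, mul_sub, Matrix.smul_mul, Matrix.mul_smul, hSS, hSE, hES, hEE, smul_smul]
  match_scalars <;> field_simp <;> ring

lemma Dnd_two_cast (d : ℕ) [NeZero d] : (Dnd 2 d : ℂ) = d * (d + 1) / 2 := by
  have h : 2 + d - 1 = d + 1 := by omega
  rw [Dnd, h, Nat.cast_choose_two]
  push_cast
  ring

lemma Dnd_three_cast (d : ℕ) [NeZero d] : (Dnd 3 d : ℂ) = d * (d + 1) * (d + 2) / 6 := by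
  have h := Nat.add_one_mul_choose_eq (d + 1) 2
  have h2 : (((d + 1).choose 2 : ℕ) : ℂ) = d * (d + 1) / 2 := by
    rw [Nat.cast_choose_two]
    push_cast
    ring
  have h3 : 3 + d - 1 = d + 1 + 1 := by omega
  have h' := congrArg (Nat.cast : ℕ → ℂ) h
  push_cast at h'
  rw [Dnd, h3]
  rw [h2] at h'
  linear_combination -h' / 3

lemma pt12_Rop (d : ℕ) [NeZero d] (δ : ℝ) :
    pt12 d (Rop d δ) = ((d : ℂ) * (d + 1))⁻¹ •
      ((1 + (1 - (1 - (δ : ℂ)) ^ 2) / d) • (1 : Matrix (Idx d) (Idx d) ℂ) +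
        (1 - (δ : ℂ)) ^ 2 • flip12 d) := by
  have hd : (d : ℂ) ≠ 0 := NeZero.ne _
  have hd1 : (d : ℂ) + 1 ≠ 0 := by exact_mod_cast Nat.succ_ne_zero d
  rw [Rop, Dnd_two_cast, ← Perm3_one]
  simp only [depOn_smul, depOn_add, depOn_0_one, depOn_1_one, depOn_0_swap01, depOn_1_swap01,
    pt12_smul, pt12_add, pt12_one, pt12_swap01]
  rw [Perm3_one]
  match_scalars <;> field_simp <;> ring

lemma pt12_Qop (d : ℕ) [NeZero d] (δ : ℝ) :
    pt12 d (Qop d δ) = ((d : ℂ) * (d + 1) * (d + 2))⁻¹ •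
      ((1 + (1 - (1 - (δ : ℂ)) ^ 2) / d + 2 * δ / d + 2 * δ ^ 2 / d ^ 2) •
          (1 : Matrix (Idx d) (Idx d) ℂ) +
        (1 - (δ : ℂ)) ^ 2 • flip12 d +
        ((1 - (δ : ℂ)) * (1 + 2 * δ / d)) • (bell13 d + flip12 d * bell13 d * flip12 d) +
        (1 - (δ : ℂ)) ^ 2 • (flip12 d * bell13 d + bell13 d * flip12 d)) := by
  have hd : (d : ℂ) ≠ 0 := NeZero.ne _
  have hd1 : (d : ℂ) + 1 ≠ 0 := by exact_mod_cast Nat.succ_ne_zero d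
  have hd2 : (d : ℂ) + 2 ≠ 0 := by exact_mod_cast Nat.succ_ne_zero (d + 1)
  rw [Qop, Dnd_three_cast, projSym3, sum_perm_fin_three]
  simp only [depOn_smul, depOn_add, depOn_0_one, depOn_1_one, depOn_0_swap01, depOn_1_swap01,
    depOn_0_swap02, depOn_1_swap02, depOn_0_swap12, depOn_1_swap12, depOn_0_rotate,
    depOn_1_rotate, depOn_0_rotate_inv, depOn_1_rotate_inv,
    pt12_smul, pt12_add, pt12_one, pt12_swap01, pt12_swap02, pt12_swap12, pt12_rotate,
    pt12_rotate_inv]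
  match_scalars <;> field_simp <;> ring

/-- The dual certificate: `λ₀ R - Q` is, after partial transposition, a combination of two
projectors and a Wigner-positive operator. -/
lemma dual_certificate (d : ℕ) [NeZero d] (hd : 3 ≤ d) (δ : ℝ) {c s : ℂ}
    (hc : c = (1 - δ) * (1 + 2 * δ / d))
    (hs : s = (d + 2) / d * ((1 - δ) * δ * (1 - (d - 1) * δ / d))) :
    ((d : ℂ) * (d + 1) * (d + 2)) •
      ((1 - ((d : ℂ) - 1) * δ / d) • pt12 d (Rop d δ) - pt12 d (Qop d δ)) =
      ((c + (1 - δ) ^ 2 - s) * (d + 1)) • complProj d 1 +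
      ((c - (1 - δ) ^ 2 + s) * (d - 1)) • complProj d (-1) +
      s • ((2 : ℂ) • 1 + (-1 : ℂ) • (flip12 d * bell13 d) +
        (-1 : ℂ) • (bell13 d * flip12 d)) := by
  have hd0 : (d : ℂ) ≠ 0 := NeZero.ne _
  have hd1 : (d : ℂ) + 1 ≠ 0 := by exact_mod_cast Nat.succ_ne_zero d
  have hd2 : (d : ℂ) + 2 ≠ 0 := by exact_mod_cast Nat.succ_ne_zero (d + 1)
  have hd3 : (d : ℂ) - 1 ≠ 0 := sub_ne_zero.mpr (by exact_mod_cast (by omega : d ≠ 1))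
  have hd3' : (d : ℂ) + -1 ≠ 0 := by rwa [← sub_eq_add_neg]
  rw [pt12_Rop, pt12_Qop, complProj, complProj, hs, hc]
  simp only [add_mul, mul_add, one_mul, mul_one, Matrix.smul_mul, Matrix.mul_smul]
  match_scalars <;> field_simp <;> ring

/-- No-go theorem for universal probabilistic purification via CPWP operations
(upper bound): any trace-non-increasing, completely positive-Wigner-preserving
two-to-one Choi operator J with success probability p has normalized purification
fidelity at most λ₀ = 1 − (d−1)δ/d. -/
theorem no_go_universal_purification_CPWP_upper_bound
    (d : ℕ) [NeZero d] (hd : 3 ≤ d) (hodd : Odd d)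
    (δ : ℝ) (hδ : δ ∈ Set.Icc (0 : ℝ) 1) (p : ℝ) (hp : p ∈ Set.Ioc (0 : ℝ) 1)
    (J : Matrix (Idx d) (Idx d) ℂ) (hJpsd : J.PosSemidef)
    (hJtn : (1 - ptrace3 d J).PosSemidef)
    (hJwigner : ∀ r w v : ZMod d × ZMod d,
      0 ≤ ((kron3 d (Apt d r)ᵀ (Apt d w)ᵀ (Apt d v) * J).trace).re)
    (hJprob : (J * pt12 d (Rop d δ)).trace = (p : ℂ)) :
    ((J * pt12 d (Qop d δ)).trace).re / p ≤ 1 - ((d : ℝ) - 1) * δ / d := by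
  have hd3 : (3 : ℝ) ≤ d := by exact_mod_cast hd
  obtain ⟨hδ0, hδ1⟩ := hδ
  obtain ⟨hp0, -⟩ := hp
  set c : ℝ := (1 - δ) * (1 + 2 * δ / d) with hc
  set l : ℝ := 1 - ((d : ℝ) - 1) * δ / d with hl
  set s : ℝ := (d + 2) / d * ((1 - δ) * δ * l) with hs
  have hl0 : 0 ≤ l := by
    have : ((d : ℝ) - 1) * δ / d ≤ 1 := by
      rw [div_le_one (by linarith)]
      nlinarith
    linarith
  have hl1 : l ≤ 1 := by
    have : 0 ≤ ((d : ℝ) - 1) * δ / d := div_nonneg (mul_nonneg (by linarith) hδ0) (by linarith)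
    linarith
  have hq : 0 ≤ (1 - δ) * δ := mul_nonneg (by linarith) hδ0
  have hs0 : 0 ≤ s := by positivity
  have hcsub : c - (1 - δ) ^ 2 = (d + 2) / d * ((1 - δ) * δ) := by
    rw [hc]
    field_simp
    ring
  have hsc : s ≤ c - (1 - δ) ^ 2 := by
    rw [hcsub, hs]
    exact mul_le_mul_of_nonneg_left (mul_le_of_le_one_right hq hl1) (by positivity)
  have hα : 0 ≤ (c + (1 - δ) ^ 2 - s) * (d + 1) :=
    mul_nonneg (by nlinarith [sq_nonneg (1 - δ)]) (by linarith)
  have hβ : 0 ≤ (c - (1 - δ) ^ 2 + s) * (d - 1) := mul_nonneg (by linarith) (by linarith)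
  have hdp : ((d : ℂ) + 1) ≠ 0 := by exact_mod_cast Nat.succ_ne_zero d
  have hdm : ((d : ℂ) + -1) ≠ 0 := by
    rw [← sub_eq_add_neg]
    exact sub_ne_zero.mpr (by exact_mod_cast (by omega : d ≠ 1))
  have hplus := trace_mul_re_nonneg_of_idempotent hJpsd
    (complProj_conjTranspose d (ε := 1) (by simp)) (complProj_mul_self d (by ring) hdp)
  have hminus := trace_mul_re_nonneg_of_idempotent hJpsd
    (complProj_conjTranspose d (ε := -1) (by simp)) (complProj_mul_self d (by ring) hdm)
  have hcyc := trace_mul_pt12_cyclic_re_nonneg d hodd J hJwigner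
  have key := congrArg (fun M => (J * M).trace.re)
    (dual_certificate d hd δ (c := c) (s := s) (by rw [hc]; push_cast; ring)
      (by rw [hs, hl]; push_cast; ring))
  have e₀ : ((d : ℂ) * (d + 1) * (d + 2)) = ((d * (d + 1) * (d + 2) : ℝ) : ℂ) := by
    push_cast; ring
  have e₁ : (1 - ((d : ℂ) - 1) * δ / d) = (l : ℂ) := by rw [hl]; push_cast; ring
  have e₂ : ((c : ℂ) + (1 - δ) ^ 2 - s) * (d + 1) =
      (((c + (1 - δ) ^ 2 - s) * (d + 1) : ℝ) : ℂ) := by push_cast; ring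
  have e₃ : ((c : ℂ) - (1 - δ) ^ 2 + s) * (d - 1) =
      (((c - (1 - δ) ^ 2 + s) * (d - 1) : ℝ) : ℂ) := by push_cast; ring
  rw [e₀, e₁, e₂, e₃] at key
  generalize (2 : ℂ) • 1 + (-1 : ℂ) • (flip12 d * bell13 d) +
      (-1 : ℂ) • (bell13 d * flip12 d) = W at key hcyc
  simp only [mul_add, mul_sub, Matrix.mul_smul, trace_add, trace_sub, trace_smul, smul_eq_mul,
    Complex.add_re, Complex.sub_re, Complex.re_ofReal_mul, hJprob, Complex.ofReal_re] at key
  have hrhs := add_nonneg (add_nonneg (mul_nonneg hα hplus) (mul_nonneg hβ hminus))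
    (mul_nonneg hs0 hcyc)
  rw [div_le_iff₀ hp0]
  refine sub_nonneg.mp (nonneg_of_mul_nonneg_right (a := (d : ℝ) * (d + 1) * (d + 2)) ?_
    (by positivity))
  linarith
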